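/- Let S be a finite set and M the set of 1-bounded pseudometrics on S, ordered by m₁ ⪯ m₂ iff m₁(s,t) ≥ m₂(s,t) for all s,t ∈ S. Then (M, ⪯) is a complete lattice. -/

import Mathlib

/-- A 1-bounded pseudometric on `S`: a function `m : S × S → [0,1]` with
`m s s = 0`, symmetry and the triangle inequality. -/
structure BPM (S : Type*) where
  d : S → S → ℝ
  nonneg : ∀ s t, 0 ≤ d s t
  le_one : ∀ s t, d s t ≤ 1
  refl : ∀ s, d s s = 0
  symm : ∀ s t, d s t = d t s
  triangle : ∀ s t u, d s t ≤ d s u + d u t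

namespace BPM

variable {S : Type*}

@[ext]
theorem ext {m₁ m₂ : BPM S} (h : ∀ s t, m₁.d s t = m₂.d s t) : m₁ = m₂ := by
  cases m₁
  cases m₂
  congr
  funext s t
  exact h s t

/-- The order `⪯`: `m₁ ≤ m₂` iff `m₂` is pointwise at most `m₁`. -/
@[reducible]
def partialOrder : PartialOrder (BPM S) where
  le m₁ m₂ := ∀ s t, m₂.d s t ≤ m₁.d s t
  le_refl _ _ _ := le_rfl
  le_trans _ _ _ h₁ h₂ s t := (h₂ s t).trans (h₁ s t)
  le_antisymm _ _ h₁ h₂ := ext fun s t => le_antisymm (h₂ s t) (h₁ s t)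

attribute [local instance] partialOrder

theorem d_le_iSup (A : Set (BPM S)) {m : BPM S} (hm : m ∈ A) (s t : S) :
    m.d s t ≤ ⨆ m : A, m.1.d s t :=
  le_ciSup (f := fun m : A => m.1.d s t)
    ⟨1, Set.forall_mem_range.2 fun m => m.1.le_one s t⟩ ⟨m, hm⟩

theorem iSup_d_nonneg (A : Set (BPM S)) (s t : S) : 0 ≤ ⨆ m : A, m.1.d s t :=
  Real.iSup_nonneg fun m => m.1.nonneg s t

/-- The infimum for `⪯` is the pointwise supremum; the supremum over the empty family is `0`,
which is the `⪯`-greatest pseudometric. -/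
@[reducible]
noncomputable def infSet : InfSet (BPM S) where
  sInf A :=
    { d := fun s t => ⨆ m : A, m.1.d s t
      nonneg := iSup_d_nonneg A
      le_one := fun s t => Real.iSup_le (fun m => m.1.le_one s t) zero_le_one
      refl := fun s => by simp [BPM.refl]
      symm := fun s t => iSup_congr fun m => m.1.symm s t
      triangle := fun s t u => Real.iSup_le
        (fun m => (m.1.triangle s t u).trans
          (add_le_add (d_le_iSup A m.2 s u) (d_le_iSup A m.2 u t)))
        (add_nonneg (iSup_d_nonneg A s u) (iSup_d_nonneg A u t)) }

attribute [local instance] infSet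

theorem isGLB_sInf (A : Set (BPM S)) : IsGLB A (sInf A) :=
  ⟨fun _ hm s t => d_le_iSup A hm s t,
    fun b hb s t => Real.iSup_le (fun m => hb m.2 s t) (b.nonneg s t)⟩

/-- The complete lattice of 1-bounded pseudometrics under `⪯`. -/
@[reducible]
noncomputable def completeLattice : CompleteLattice (BPM S) :=
  completeLatticeOfInf (BPM S) isGLB_sInf

end BPM

/-- The set `M` of 1-bounded pseudometrics on a finite set `S`, ordered by
`m₁ ⪯ m₂` iff `∀ s t, m₁ s t ≥ m₂ s t`, is a complete lattice: there is a
complete lattice structure on `M` whose order is exactly `⪯`. -/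
theorem bpm_completeLattice (S : Type*) [Fintype S] :
    ∃ inst : CompleteLattice (BPM S),
      ∀ m₁ m₂ : BPM S,
        (letI := inst; m₁ ≤ m₂) ↔ ∀ s t, m₂.d s t ≤ m₁.d s t := by
  exact ⟨BPM.completeLattice, fun _ _ => Iff.rfl⟩
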